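/- Let n > 1 and let a ∈ ℝ^n be (c,q)-badly approximable by rationals. Then there exists a constant C > 0, depending only on n, q and c, such that for all ε > 0, T_a(ε) ≤ C ε^{-((q+1)n(n+1)/2 + q ∑_{i=0}^{n-2} (i+1)(2n-i)/2)}. -/

import Mathlib

open Finset

/-- `x ∈ ℝ^n` is `(c,q)`-badly approximable by rationals: for every `ν ∈ ℤ^n \ {0}`,
`‖⟨x,ν⟩‖_𝕋 > c/‖ν‖^q`, where `‖z‖_𝕋` is the distance to the nearest integer and `‖ν‖` is
the `ℓ¹`-norm. -/
def IsBAP {n : ℕ} (c : ℝ) (q : ℕ) (x : Fin n → ℝ) : Prop :=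
  ∀ ν : Fin n → ℤ, ν ≠ 0 →
    c / (∑ i, |(ν i : ℝ)|) ^ q <
      |(∑ i, x i * (ν i : ℝ)) - round (∑ i, x i * (ν i : ℝ))|

/-- The additive character `t ↦ exp (2πit)` of `ℝ`. -/
noncomputable def unitExp (t : ℝ) : ℂ := Complex.exp (Complex.I * ((2 * Real.pi * t : ℝ) : ℂ))

lemma unitExp_zero : unitExp 0 = 1 := by simp [unitExp]

lemma unitExp_add (s t : ℝ) : unitExp (s + t) = unitExp s * unitExp t := by
  rw [unitExp, unitExp, unitExp, ← Complex.exp_add]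
  congr 1
  push_cast
  ring

lemma unitExp_natCast_mul (k : ℕ) (t : ℝ) : unitExp (k * t) = unitExp t ^ k := by
  rw [unitExp, unitExp, ← Complex.exp_nat_mul]
  congr 1
  push_cast
  ring

lemma unitExp_sum {ι : Type*} (s : Finset ι) (f : ι → ℝ) :
    unitExp (∑ i ∈ s, f i) = ∏ i ∈ s, unitExp (f i) := by
  simp only [unitExp, ← Complex.exp_sum, Finset.mul_sum, Complex.ofReal_sum]

lemma norm_unitExp (t : ℝ) : ‖unitExp t‖ = 1 := by
  rw [unitExp, mul_comm, Complex.norm_exp_ofReal_mul_I]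

lemma conj_unitExp (t : ℝ) : (starRingEnd ℂ) (unitExp t) = unitExp (-t) := by
  rw [unitExp, unitExp, ← Complex.exp_conj]
  congr 1
  simp [Complex.conj_ofNat]

lemma four_mul_abs_sub_round_le_norm_unitExp_sub_one (t : ℝ) :
    4 * |t - round t| ≤ ‖unitExp t - 1‖ := by
  have hround : |t - round t| ≤ 1 / 2 := abs_sub_round t
  have hsin : |Real.sin (Real.pi * t)| = |Real.sin (Real.pi * (t - round t))| := by
    rw [mul_sub, mul_comm Real.pi (round t : ℝ), Real.sin_sub_int_mul_pi, abs_mul, abs_zpow]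
    simp
  have habs : |Real.pi * (t - round t)| = Real.pi * |t - round t| := by
    rw [abs_mul, abs_of_pos Real.pi_pos]
  have hjordan := Real.mul_abs_le_abs_sin (x := Real.pi * (t - round t)) (by
    rw [habs]; nlinarith [Real.pi_pos])
  rw [habs, ← mul_assoc, div_mul_cancel₀ _ Real.pi_ne_zero] at hjordan
  rw [unitExp, Complex.norm_exp_I_mul_ofReal_sub_one, Real.norm_eq_abs, abs_mul,
    show 2 * Real.pi * t / 2 = Real.pi * t by ring, hsin, abs_two]
  linarith

lemma norm_sum_range_unitExp_le {δ t : ℝ} (hδ : 0 < δ) (ht : δ ≤ |t - round t|) (N : ℕ) :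
    ‖∑ k ∈ range N, unitExp (k * t)‖ ≤ 1 / (2 * δ) := by
  have hlow := four_mul_abs_sub_round_le_norm_unitExp_sub_one t
  have hne : unitExp t ≠ 1 := by
    intro h
    rw [h, sub_self, norm_zero] at hlow
    linarith
  simp only [unitExp_natCast_mul]
  rw [geom_sum_eq hne, norm_div]
  have hup : ‖unitExp t ^ N - 1‖ ≤ 2 := by
    refine (norm_sub_le _ _).trans ?_
    rw [norm_pow, norm_unitExp, one_pow, norm_one]
    norm_num
  rw [div_le_div_iff₀ (by linarith) (by linarith)]
  nlinarith

/-- The product of the Dirichlet-type sums `∑ l < m i, exp (2πi l x i)`. -/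
noncomputable def dirichletProd {n : ℕ} (m : Fin n → ℕ) (x : Fin n → ℝ) : ℂ :=
  ∏ i, ∑ l ∈ range (m i), unitExp (l * x i)

lemma norm_dirichletProd_sq {n : ℕ} (m : Fin n → ℕ) (x : Fin n → ℝ) :
    ((‖dirichletProd m x‖ ^ 2 : ℝ) : ℂ) =
      ∑ p ∈ Fintype.piFinset (fun i => range (m i)), ∑ r ∈ Fintype.piFinset (fun i => range (m i)),
        unitExp (∑ i, ((p i : ℝ) - r i) * x i) := by
  have hexp : dirichletProd m x =
      ∑ p ∈ Fintype.piFinset (fun i => range (m i)), unitExp (∑ i, (p i : ℝ) * x i) := by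
    simp only [dirichletProd, unitExp_sum]
    exact Finset.prod_univ_sum _ _
  rw [Complex.ofReal_pow, ← Complex.mul_conj', hexp, map_sum, Finset.sum_mul_sum]
  refine Finset.sum_congr rfl fun p _ => Finset.sum_congr rfl fun r _ => ?_
  rw [conj_unitExp, ← unitExp_add, ← Finset.sum_neg_distrib, ← Finset.sum_add_distrib]
  congr 1
  exact Finset.sum_congr rfl fun i _ => by ring

/-- If `|∑ k < N, exp (2πi k ⟨a, ν⟩)| ≤ B` for the nonzero frequencies `ν` in the difference box,
the second moment of `dirichletProd m` along the orbit is close to that of its diagonal. -/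
lemma abs_sum_norm_dirichletProd_sq_sub_le {n : ℕ} (m : Fin n → ℕ) (a z : Fin n → ℝ) (N : ℕ)
    {B : ℝ} (hB0 : 0 ≤ B)
    (hB : ∀ p r : Fin n → ℕ, (∀ i, p i < m i) → (∀ i, r i < m i) → p ≠ r →
      ‖∑ k ∈ range N, unitExp (k * ∑ i, ((p i : ℝ) - r i) * a i)‖ ≤ B) :
    |∑ k ∈ range N, ‖dirichletProd m (fun i => (k + 1 : ℝ) * a i - z i)‖ ^ 2
        - N * ∏ i, (m i : ℝ)| ≤ (∏ i, (m i : ℝ)) ^ 2 * B := by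
  set S := Fintype.piFinset (fun i => range (m i)) with hS
  have hcard : (S.card : ℝ) = ∏ i, (m i : ℝ) := by
    simp [hS, Fintype.card_piFinset]
  have hinner : ∀ p ∈ S, ∀ r ∈ S,
      ‖∑ k ∈ range N, unitExp (∑ i, ((p i : ℝ) - r i) * ((k + 1 : ℝ) * a i - z i))
        - (if p = r then (N : ℂ) else 0)‖ ≤ B := by
    intro p hp r hr
    rw [hS, Fintype.mem_piFinset] at hp hr
    split_ifs with h
    · subst h
      simpa [unitExp_zero] using hB0
    · have hsplit : ∀ k : ℕ,
          unitExp (∑ i, ((p i : ℝ) - r i) * ((k + 1 : ℝ) * a i - z i)) =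
            unitExp (∑ i, ((p i : ℝ) - r i) * (a i - z i)) *
              unitExp (k * ∑ i, ((p i : ℝ) - r i) * a i) := by
        intro k
        rw [← unitExp_add, Finset.mul_sum, ← Finset.sum_add_distrib]
        congr 1
        exact Finset.sum_congr rfl fun i _ => by ring
      simp only [hsplit]
      rw [← Finset.mul_sum, sub_zero, norm_mul, norm_unitExp, one_mul]
      exact hB p r (fun i => mem_range.1 (hp i)) (fun i => mem_range.1 (hr i)) h
  have hcomplex : ((∑ k ∈ range N, ‖dirichletProd m (fun i => (k + 1 : ℝ) * a i - z i)‖ ^ 2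
        - N * ∏ i, (m i : ℝ) : ℝ) : ℂ) =
      ∑ p ∈ S, ∑ r ∈ S,
        (∑ k ∈ range N, unitExp (∑ i, ((p i : ℝ) - r i) * ((k + 1 : ℝ) * a i - z i))
          - (if p = r then (N : ℂ) else 0)) := by
    rw [← hcard, Complex.ofReal_sub, Complex.ofReal_sum]
    simp only [norm_dirichletProd_sq, Finset.sum_sub_distrib, Finset.sum_ite_eq]
    congr 1
    · rw [Finset.sum_comm]
      exact Finset.sum_congr rfl fun p _ => Finset.sum_comm
    · simp [mul_comm]
  rw [← Real.norm_eq_abs, ← Complex.norm_real, hcomplex, ← hcard]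
  calc _ ≤ ∑ p ∈ S, ∑ r ∈ S, B :=
        norm_sum_le_of_le _ fun p hp => norm_sum_le_of_le _ fun r hr => hinner p hp r hr
    _ = (S.card : ℝ) ^ 2 * B := by simp; ring

lemma IsBAP.norm_sum_range_unitExp_le {n : ℕ} {c : ℝ} (hc : 0 < c) {q : ℕ} {a : Fin n → ℝ}
    (ha : IsBAP c q a) {M : ℕ} {p r : Fin n → ℕ} (hp : ∀ i, p i < M) (hr : ∀ i, r i < M)
    (hpr : p ≠ r) (N : ℕ) :
    ‖∑ k ∈ range N, unitExp (k * ∑ i, ((p i : ℝ) - r i) * a i)‖ ≤ (n * M : ℝ) ^ q / (2 * c) := by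
  obtain ⟨j, hj⟩ := Function.ne_iff.1 hpr
  set ν : Fin n → ℤ := fun i => (p i : ℤ) - r i with hν
  have hνne : ν ≠ 0 := fun h => hj (by
    have := congrFun h j
    simp only [hν, Pi.zero_apply] at this
    omega)
  have hle : ∑ i, |(ν i : ℝ)| ≤ n * M := by
    calc ∑ i, |(ν i : ℝ)| ≤ ∑ _i : Fin n, (M : ℝ) := by
          refine Finset.sum_le_sum fun i _ => ?_
          have h : |ν i| ≤ M := by
            have := hp i
            have := hr i
            rw [abs_le]
            constructor <;> simp only [hν] <;> omega
          exact_mod_cast h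
      _ = n * M := by simp
  have hpos : 0 < ∑ i, |(ν i : ℝ)| := by
    obtain ⟨i, hi⟩ := Function.ne_iff.1 hνne
    refine Finset.sum_pos' (fun i _ => abs_nonneg _) ⟨i, mem_univ _, abs_pos.2 ?_⟩
    exact_mod_cast hi
  have hsum : ∑ i, ((p i : ℝ) - r i) * a i = ∑ i, a i * (ν i : ℝ) :=
    Finset.sum_congr rfl fun i _ => by simp [hν, mul_comm]
  rw [hsum]
  have hMpos : 0 < (n * M : ℝ) := hpos.trans_le hle
  have hδ : c / (n * M : ℝ) ^ q ≤
      |(∑ i, a i * (ν i : ℝ)) - round (∑ i, a i * (ν i : ℝ))| :=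
    (div_le_div_of_nonneg_left hc.le (by positivity) (by gcongr)).trans (ha ν hνne).le
  refine (_root_.norm_sum_range_unitExp_le (by positivity) hδ N).trans_eq ?_
  field_simp

/-- A vector of positive dimension cannot have linear forms bounded away from the integers. -/
lemma IsBAP.exponent_pos {n : ℕ} (hn : 0 < n) {c : ℝ} (hc : 0 < c) {q : ℕ} {a : Fin n → ℝ}
    (ha : IsBAP c q a) : 0 < q := by
  rcases Nat.eq_zero_or_pos q with rfl | hq
  · exfalso
    obtain ⟨m, hm⟩ := exists_nat_gt (1 / c)
    have hm0 : 0 < m := by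
      have : (0 : ℝ) < m := lt_trans (by positivity) hm
      exact_mod_cast this
    obtain ⟨k, hk0, -, hk⟩ := Real.exists_nat_abs_mul_sub_round_le (a ⟨0, hn⟩) hm0
    have h := ha (Pi.single ⟨0, hn⟩ (k : ℤ)) (by
      rw [Ne, Pi.single_eq_zero_iff]
      omega)
    have hsum : ∑ i, a i * ((Pi.single (⟨0, hn⟩ : Fin n) (k : ℤ) : Fin n → ℤ) i : ℝ) =
        k * a ⟨0, hn⟩ := by
      rw [Finset.sum_eq_single ⟨0, hn⟩ (fun i _ hi => by simp [Pi.single_eq_of_ne hi])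
        (fun h => absurd (mem_univ _) h)]
      simp [mul_comm]
    rw [hsum, pow_zero, div_one] at h
    have h2 : 1 / ((m : ℝ) + 1) < c := by
      rw [div_lt_iff₀ (by positivity)]
      rw [div_lt_iff₀ hc] at hm
      nlinarith
    linarith
  · exact hq

/-- If no point of the orbit is `ε`-close to `z`, then the orbit is short. -/
lemma IsBAP.natCast_lt_of_forall_exists_le {n : ℕ} {c : ℝ} (hc : 0 < c) {q : ℕ} {a : Fin n → ℝ}
    (ha : IsBAP c q a) {z : Fin n → ℝ} {ε : ℝ} (hε : 0 < ε) {M N : ℕ} (hM0 : 0 < M)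
    (hn : 0 < n) (hM : n / ε ^ 2 ≤ M)
    (hfar : ∀ k ∈ range N, ∃ j, ε ≤
      |((k + 1 : ℝ) * a j - z j) - round ((k + 1 : ℝ) * a j - z j)|) :
    (N : ℝ) < (M : ℝ) ^ n * ((n * M : ℝ) ^ q / c) := by
  set B : ℝ := (n * M : ℝ) ^ q / (2 * c) with hBdef
  have hn' : (0 : ℝ) < n := by exact_mod_cast hn
  have hM' : (1 : ℝ) ≤ M := by exact_mod_cast hM0
  have hBpos : 0 < B := by positivity
  set x : ℕ → Fin n → ℝ := fun k i => (k + 1 : ℝ) * a i - z i with hx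
  have hmoment : ∀ m : Fin n → ℕ, (∀ i, m i ≤ M) →
      |∑ k ∈ range N, ‖dirichletProd m (x k)‖ ^ 2 - N * ∏ i, (m i : ℝ)| ≤
        (∏ i, (m i : ℝ)) ^ 2 * B := fun m hm =>
    abs_sum_norm_dirichletProd_sq_sub_le m a z N hBpos.le fun p r hp hr hpr =>
      ha.norm_sum_range_unitExp_le hc (fun i => (hp i).trans_le (hm i))
        (fun i => (hr i).trans_le (hm i)) hpr N
  set m' : Fin n → Fin n → ℕ := fun j => Function.update (fun _ => M) j 1 with hm'
  have hprod' : ∀ j, (M : ℝ) * ∏ i, (m' j i : ℝ) = (M : ℝ) ^ n := by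
    intro j
    have h1 : ∏ i, (m' j i : ℝ) = ∏ i ∈ univ.erase j, (M : ℝ) := by
      rw [← Finset.mul_prod_erase univ _ (mem_univ j)]
      simp only [hm', Function.update_self, Nat.cast_one, one_mul]
      exact Finset.prod_congr rfl fun i hi => by
        rw [Function.update_of_ne (Finset.ne_of_mem_erase hi)]
    rw [h1, Finset.mul_prod_erase univ (fun _ => (M : ℝ)) (mem_univ j)]
    simp
  have hfactor : ∀ k j, dirichletProd (fun _ => M) (x k) =
      (∑ l ∈ range M, unitExp (l * x k j)) * dirichletProd (m' j) (x k) := by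
    intro k j
    rw [dirichletProd, dirichletProd, ← Finset.mul_prod_erase univ _ (mem_univ j),
      ← Finset.mul_prod_erase univ (fun i => ∑ l ∈ range (m' j i), unitExp (l * x k i))
        (mem_univ j)]
    simp only [hm', Function.update_self, Finset.sum_range_one, Nat.cast_zero, zero_mul,
      unitExp_zero, one_mul]
    congr 1
    exact Finset.prod_congr rfl fun i hi => by
      rw [Function.update_of_ne (Finset.ne_of_mem_erase hi)]
  have hpoint : ∀ k ∈ range N, ‖dirichletProd (fun _ => M) (x k)‖ ^ 2 ≤
      ∑ j, 1 / (4 * ε ^ 2) * ‖dirichletProd (m' j) (x k)‖ ^ 2 := by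
    intro k hk
    obtain ⟨j, hj⟩ := hfar k hk
    refine le_trans ?_ (Finset.single_le_sum (fun i _ => by positivity) (mem_univ j))
    rw [hfactor k j, norm_mul, mul_pow]
    have h := _root_.norm_sum_range_unitExp_le hε hj M
    have h2 : ‖∑ l ∈ range M, unitExp (l * x k j)‖ ^ 2 ≤ 1 / (4 * ε ^ 2) := by
      calc _ ≤ (1 / (2 * ε)) ^ 2 := pow_le_pow_left₀ (norm_nonneg _) h 2
        _ = _ := by rw [div_pow, mul_pow]; norm_num
    exact mul_le_mul_of_nonneg_right h2 (by positivity)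
  have hlow := (abs_le.1 (hmoment (fun _ => M) fun _ => le_rfl)).1
  have hup : ∀ j, ∑ k ∈ range N, ‖dirichletProd (m' j) (x k)‖ ^ 2 ≤
      (N * (M : ℝ) ^ n + ((M : ℝ) ^ n) ^ 2 * B) / M := by
    intro j
    have h := (abs_le.1 (hmoment (m' j) fun i => by
      by_cases hij : i = j
      · subst hij
        simpa [hm'] using Nat.succ_le_of_lt hM0
      · simp [hm', Function.update_of_ne hij])).2
    rw [le_div_iff₀ (by linarith), ← hprod' j]
    set P : ℝ := ∏ i, (m' j i : ℝ)
    have hP : 0 ≤ P ^ 2 * B := by positivity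
    nlinarith [mul_le_mul_of_nonneg_left hM' (mul_nonneg hP (by linarith : (0 : ℝ) ≤ M))]
  have htotal : ∑ k ∈ range N, ‖dirichletProd (fun _ => M) (x k)‖ ^ 2 ≤
      (N * (M : ℝ) ^ n + ((M : ℝ) ^ n) ^ 2 * B) / 4 := by
    set T : ℝ := N * (M : ℝ) ^ n + ((M : ℝ) ^ n) ^ 2 * B with hT
    have hT0 : 0 ≤ T := by positivity
    calc _ ≤ ∑ k ∈ range N, ∑ j, 1 / (4 * ε ^ 2) * ‖dirichletProd (m' j) (x k)‖ ^ 2 :=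
          Finset.sum_le_sum hpoint
      _ = ∑ j, 1 / (4 * ε ^ 2) * ∑ k ∈ range N, ‖dirichletProd (m' j) (x k)‖ ^ 2 := by
          rw [Finset.sum_comm]
          simp only [Finset.mul_sum]
      _ ≤ ∑ _j : Fin n, 1 / (4 * ε ^ 2) * (T / M) :=
          Finset.sum_le_sum fun j _ => mul_le_mul_of_nonneg_left (hup j) (by positivity)
      _ = n / ε ^ 2 * (T / M / 4) := by
          simp only [Finset.sum_const, Finset.card_univ, Fintype.card_fin, nsmul_eq_mul]
          field_simp
      _ ≤ M * (T / M / 4) := mul_le_mul_of_nonneg_right hM (by positivity)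
      _ = T / 4 := by field_simp
  simp only [Finset.prod_const, Finset.card_univ, Fintype.card_fin] at hlow
  have hD : (0 : ℝ) < (M : ℝ) ^ n := by positivity
  have hB2 : (n * M : ℝ) ^ q / c = 2 * B := by
    rw [hBdef]
    field_simp
  rw [hB2]
  set D : ℝ := (M : ℝ) ^ n
  have h3 : D * (3 * N) ≤ D * (5 * (D * B)) := by nlinarith
  have h4 := le_of_mul_le_mul_left h3 hD
  nlinarith [mul_pos hD hBpos]

lemma four_mul_add_le_exponent {n q : ℕ} (hn : 1 < n) (hq : 0 < q) :
    4 * (n + q) ≤ (q + 1) * n * (n + 1) + q * ∑ i ∈ Finset.range (n - 1),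
      (i + 1) * (2 * n - i) := by
  have hsum : 2 * n ≤ ∑ i ∈ Finset.range (n - 1), (i + 1) * (2 * n - i) :=
    le_trans (by simp) (Finset.single_le_sum (f := fun i => (i + 1) * (2 * n - i))
      (fun i _ => Nat.zero_le _) (mem_range.2 (by omega : 0 < n - 1)))
  have h2 := Nat.mul_le_mul_left q hsum
  obtain ⟨n, rfl⟩ := Nat.exists_eq_add_of_le hn
  obtain ⟨q, rfl⟩ := Nat.exists_eq_add_of_le hq
  nlinarith [Nat.zero_le (q * n), Nat.zero_le (q * n * n), Nat.zero_le (n * n)]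

/-- Let `n > 1`. For every `(c,q)`-badly approximable `a ∈ ℝ^n` there is a constant `C > 0`,
depending only on `n`, `q` and `c`, such that for every `ε > 0`,
`T_a(ε) ≤ C ε^{-((q+1)n(n+1)/2 + q ∑_{i=0}^{n-2} (i+1)(2n-i)/2)}`: the orbit
`a, 2a, …, Na` taken mod `ℤ^n` is `ε`-dense in `𝕋^n` for every `N` at least this bound. -/
theorem torus_orbit_eps_dense (n : ℕ) (hn : 1 < n) (c : ℝ) (hc : 0 < c) (q : ℕ) :
    ∃ C > 0, ∀ a : Fin n → ℝ, IsBAP c q a → ∀ ε : ℝ, 0 < ε → ∀ N : ℕ,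
      C * ε ^ (-((((q + 1) * n * (n + 1) + q * ∑ i ∈ Finset.range (n - 1),
          (i + 1) * (2 * n - i) : ℕ) : ℝ) / 2)) ≤ (N : ℝ) →
      ∀ z : Fin n → AddCircle (1 : ℝ), ∃ k ∈ Finset.Icc 1 N,
        dist (fun i => (((k : ℝ) * a i : ℝ) : AddCircle (1 : ℝ))) z ≤ ε := by
  have hn0 : 0 < n := by omega
  have hn' : (0 : ℝ) < n := by exact_mod_cast hn0
  have hn1 : (1 : ℝ) ≤ n := by exact_mod_cast hn0
  refine ⟨(2 * n : ℝ) ^ n * ((n * (2 * n) : ℝ) ^ q / c), by positivity, ?_⟩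
  intro a ha ε hε N hN z
  have hq := ha.exponent_pos hn0 hc
  set E : ℕ := (q + 1) * n * (n + 1) + q * ∑ i ∈ Finset.range (n - 1), (i + 1) * (2 * n - i)
    with hE
  have hNpos : 0 < N := by
    have : (0 : ℝ) < N := lt_of_lt_of_le (by positivity) hN
    exact_mod_cast this
  choose w hw using fun i => QuotientAddGroup.mk_surjective (z i)
  have hdist : ∀ (t : ℝ) (i : Fin n), dist ((t : ℝ) : AddCircle (1 : ℝ)) (z i) =
      |(t - w i) - round (t - w i)| := by
    intro t i
    rw [← hw i, dist_eq_norm, ← UnitAddCircle.norm_eq]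
    rfl
  rcases le_total 1 ε with hε1 | hε1
  · refine ⟨1, Finset.mem_Icc.2 ⟨le_rfl, hNpos⟩, (dist_pi_le_iff hε.le).2 fun i => ?_⟩
    rw [hdist]
    exact (abs_sub_round _).trans (by linarith)
  by_contra! hfar
  set M : ℕ := ⌈(n : ℝ) / ε ^ 2⌉₊ with hMdef
  have hquot : 1 ≤ (n : ℝ) / ε ^ 2 := by
    rw [le_div_iff₀ (by positivity)]
    nlinarith
  have hM0 : 0 < M := Nat.ceil_pos.2 (by positivity)
  have hMle : (M : ℝ) ≤ 2 * n / ε ^ 2 := by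
    have := (Nat.ceil_lt_add_one (by positivity : 0 ≤ (n : ℝ) / ε ^ 2)).le
    rw [mul_div_assoc]
    linarith
  have hlt := ha.natCast_lt_of_forall_exists_le hc hε hM0 hn0 (Nat.le_ceil _) (z := w) (N := N)
    (fun k hk => by
      have h := hfar (k + 1) (Finset.mem_Icc.2 ⟨by omega, mem_range.1 hk⟩)
      by_contra! hclose
      refine h.not_ge ((dist_pi_le_iff hε.le).2 fun i => ?_)
      rw [hdist, Nat.cast_add_one]
      exact (hclose i).le)
  have hpow : (ε ^ 2)⁻¹ ^ (n + q) ≤ ε ^ (-((E : ℝ) / 2)) := by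
    have h4 : (4 * (n + q) : ℝ) ≤ E := by exact_mod_cast four_mul_add_le_exponent hn hq
    calc (ε ^ 2)⁻¹ ^ (n + q) = ε ^ (-((2 * (n + q) : ℕ) : ℝ)) := by
          rw [Real.rpow_neg hε.le, Real.rpow_natCast, inv_pow, ← pow_mul]
      _ ≤ _ := Real.rpow_le_rpow_of_exponent_ge hε hε1 (by push_cast; linarith)
  refine absurd hN (not_le.2 (hlt.trans_le ?_))
  calc (M : ℝ) ^ n * ((n * M : ℝ) ^ q / c)
      ≤ (2 * n / ε ^ 2 : ℝ) ^ n * ((n * (2 * n / ε ^ 2) : ℝ) ^ q / c) := by gcongr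
    _ = (2 * n : ℝ) ^ n * ((n * (2 * n) : ℝ) ^ q / c) * (ε ^ 2)⁻¹ ^ (n + q) := by
        rw [div_eq_mul_inv (2 * (n : ℝ)), ← mul_assoc (n : ℝ), mul_pow, mul_pow _ _ q, pow_add]
        ring
    _ ≤ _ := mul_le_mul_of_nonneg_left hpow (by positivity)
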